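/- In the plausible-deniability mechanism setup, additionally assume that for every s ∈ U the family (p s y)_{y ∈ U} is summable with Σ_{y ∈ U} p s y ≤ 1. Let t be an integer with 1 ≤ t < k, let D ⊆ U be a finite dataset, d' ∈ U with d' ∉ D, D' = D ∪ {d'}, and let Y ⊆ U. Define Y_{t-} = {y ∈ Y : p d' y > 0 and |C_{I_{d'}(y)}(D, y)| < t} and, for y with p d' y > 0, δ(D', d', y) = exp(-ε₀·(k - t)) · (1/|D'|) · Σ_{s ∈ C_{I_{d'}(y)}(D', y)} p s y. Then Σ_{y ∈ Y_{t-}} δ(D', d', y) ≤ exp(-ε₀·(k - t)). -/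

import Mathlib

open Finset

attribute [local instance] Classical.propDecidable

noncomputable section PD

variable {U : Type*}

/-- Partition number: the unique `i : ℕ` with `γ^{-(i+1)} < x ≤ γ^{-i}` (for `0 < x ≤ 1`),
    given by `⌊-log_γ x⌋`. -/
def Ipart (γ x : ℝ) : ℕ := ⌊-Real.logb γ x⌋₊

/-- Partition set `C_i(D, y) = {d ∈ D : p d y > 0 ∧ I_d(y) = i}`. -/
def Cpart (p : U → U → ℝ) (γ : ℝ) (D : Finset U) (y : U) (i : ℕ) : Finset U :=
  D.filter fun d => 0 < p d y ∧ Ipart γ (p d y) = i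

/-- Laplace upper-tail function `Pr[L ≥ x]` for `L ~ Lap(1/ε₀)`. -/
def lapTail (ε₀ x : ℝ) : ℝ :=
  if 0 ≤ x then (1 / 2) * Real.exp (-(ε₀ * x)) else 1 - (1 / 2) * Real.exp (ε₀ * x)

/-- Probability of passing the randomized privacy test from partition `i`. -/
def pt (p : U → U → ℝ) (γ ε₀ : ℝ) (k : ℕ) (D : Finset U) (i : ℕ) (y : U) : ℝ :=
  lapTail ε₀ ((k : ℝ) - ((Cpart p γ D y i).card : ℝ))

/-- Probability of producing `y` from partition `i`. -/
def q (p : U → U → ℝ) (γ ε₀ : ℝ) (k : ℕ) (D : Finset U) (i : ℕ) (y : U) : ℝ :=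
  pt p γ ε₀ k D i y * ∑ s ∈ Cpart p γ D y i, p s y

/-- Probability that the mechanism `F` on input dataset `D` releases `y`. -/
def PF (p : U → U → ℝ) (γ ε₀ : ℝ) (k : ℕ) (D : Finset U) (y : U) : ℝ :=
  (1 / (D.card : ℝ)) *
    ∑ s ∈ D.filter (fun s => 0 < p s y), p s y * pt p γ ε₀ k D (Ipart γ (p s y)) y

/-- The sum of the probabilities of `y` over a partition is at most the sum over the dataset. -/
theorem sum_Cpart_le {p : U → U → ℝ} (hp : ∀ d y, 0 ≤ p d y) (γ : ℝ) (D : Finset U) (y : U)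
    (i : ℕ) : ∑ s ∈ Cpart p γ D y i, p s y ≤ ∑ s ∈ D, p s y :=
  Finset.sum_le_sum_of_subset_of_nonneg (Finset.filter_subset _ _) fun s _ _ => hp s y

/-- A finite family of subprobability mass functions has total mass at most its cardinality. -/
theorem tsum_sum_le_card {p : U → U → ℝ}
    (hsum : ∀ s : U, Summable (fun y : U => p s y) ∧ (∑' y : U, p s y) ≤ 1) (D : Finset U) :
    ∑' y : U, ∑ s ∈ D, p s y ≤ (D.card : ℝ) := by
  rw [Summable.tsum_finsetSum fun s _ => (hsum s).1]
  simpa using Finset.sum_le_sum fun s (_ : s ∈ D) => (hsum s).2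

/-- Restricting to a set of outputs, and to one partition for each output, keeps the total mass
of the seeds in `D` at most `D.card`. -/
theorem tsum_sum_Cpart_le_card {p : U → U → ℝ} (hp : ∀ d y, 0 ≤ p d y)
    (hsum : ∀ s : U, Summable (fun y : U => p s y) ∧ (∑' y : U, p s y) ≤ 1)
    (γ : ℝ) (D : Finset U) (i : U → ℕ) (S : Set U) :
    ∑' y : S, ∑ s ∈ Cpart p γ D (y : U) (i y), p s (y : U) ≤ (D.card : ℝ) := by
  have hD : Summable fun y : U => ∑ s ∈ D, p s y := summable_sum fun s _ => (hsum s).1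
  have hDS : Summable fun y : S => ∑ s ∈ D, p s (y : U) := hD.subtype S
  have hC : Summable fun y : S => ∑ s ∈ Cpart p γ D (y : U) (i y), p s (y : U) :=
    hDS.of_nonneg_of_le (fun y => Finset.sum_nonneg fun s _ => hp s y)
      fun y => sum_Cpart_le hp γ D y (i y)
  calc ∑' y : S, ∑ s ∈ Cpart p γ D (y : U) (i y), p s (y : U)
      ≤ ∑' y : S, ∑ s ∈ D, p s (y : U) :=
        hC.tsum_le_tsum (fun y => sum_Cpart_le hp γ D y (i y)) hDS
    _ ≤ ∑' y : U, ∑ s ∈ D, p s y :=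
        hD.tsum_subtype_le _ S fun y => Finset.sum_nonneg fun s _ => hp s y
    _ ≤ (D.card : ℝ) := tsum_sum_le_card hsum D

/-- Summing `δ(D', d', y)` over the set `Y_{t-}` of outputs whose partition of `d'` in `D`
has fewer than `t` records yields at most `e^{-ε₀(k-t)}`. -/
theorem sum_delta_le (γ ε₀ : ℝ) (hγ : 1 < γ) (hε : 0 < ε₀)
    (k : ℕ) (hk : 1 ≤ k) (t : ℕ) (ht : 1 ≤ t) (htk : t < k)
    (p : U → U → ℝ) (hp : ∀ d y, 0 ≤ p d y ∧ p d y ≤ 1)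
    (hsum : ∀ s : U, Summable (fun y : U => p s y) ∧ (∑' y : U, p s y) ≤ 1)
    (D : Finset U) (d' : U) (hd' : d' ∉ D) (D' : Finset U) (hD' : D' = insert d' D)
    (Y : Set U) :
    (∑' y : {y : U // y ∈ Y ∧ 0 < p d' y ∧ (Cpart p γ D y (Ipart γ (p d' y))).card < t},
        Real.exp (-(ε₀ * ((k : ℝ) - t))) * (1 / (D'.card : ℝ)) *
          ∑ s ∈ Cpart p γ D' (y : U) (Ipart γ (p d' (y : U))), p s (y : U)) ≤
      Real.exp (-(ε₀ * ((k : ℝ) - t))) := by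
  rw [tsum_mul_left, mul_assoc]
  refine mul_le_of_le_one_right (Real.exp_pos _).le ?_
  rw [one_div_mul_eq_div]
  exact div_le_one_of_le₀
    (tsum_sum_Cpart_le_card (fun d y => (hp d y).1) hsum γ D'
      (fun y => Ipart γ (p d' y))
      {y | y ∈ Y ∧ 0 < p d' y ∧ (Cpart p γ D y (Ipart γ (p d' y))).card < t})
    (Nat.cast_nonneg _)

end PD
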